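/- Let R > 0, k ≥ 1, m ≥ 1, and x, y ∈ ℝ^k with ‖x − y‖₁ ≤ R/2. Let u^{(1)}, …, u^{(m)} be independent random vectors, each with coordinates independent and uniformly distributed on [0, R), and for each z define h_{u^{(z)}}(w) = (⌊(w_i+u^{(z)}_i)/R⌋)_{i=1}^{k}. Then the probability that there exists z ∈ [m] with h_{u^{(z)}}(x) = h_{u^{(z)}}(y) is at least 1 − 2^{−m}. -/

import Mathlib

open MeasureTheory

/-- The uniform probability measure on the interval `[0, R)`. -/
noncomputable def uniformIco (R : ℝ) : Measure ℝ :=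
  (ENNReal.ofReal R)⁻¹ • volume.restrict (Set.Ico 0 R)

lemma isProbabilityMeasure_uniformIco {R : ℝ} (hR : 0 < R) :
    IsProbabilityMeasure (uniformIco R) := by
  refine ⟨?_⟩
  simp only [uniformIco, Measure.smul_apply, smul_eq_mul, Measure.restrict_apply_univ,
    Real.volume_Ico, sub_zero]
  exact ENNReal.inv_mul_cancel (by simpa using hR) ENNReal.ofReal_ne_top

lemma measurableSet_floor_ne (R a b : ℝ) :
    MeasurableSet {u : ℝ | ⌊(a + u) / R⌋ ≠ ⌊(b + u) / R⌋} := by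
  refine (measurableSet_eq_fun (f := fun u : ℝ => ⌊(a + u) / R⌋)
    (g := fun u : ℝ => ⌊(b + u) / R⌋) ?_ ?_).compl
  · exact Int.measurable_floor.comp (by fun_prop)
  · exact Int.measurable_floor.comp (by fun_prop)

/-- The translates of an interval by multiples of `R` cover at most its length inside `[0, R)`. -/
lemma volume_iUnion_translates_inter_Ico_le {R : ℝ} (hR : 0 < R) (a b : ℝ) :
    volume ((⋃ n : ℤ, Set.Ico (n * R - b) (n * R - a)) ∩ Set.Ico 0 R) ≤
      ENNReal.ofReal (b - a) := by
  have hdisj : Pairwise (Function.onFun Disjoint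
      fun n : ℤ => Set.Ico (-b) (-a) ∩ Set.Ico (-(n * R)) (R - n * R)) := by
    intro n p hnp
    refine Set.disjoint_left.2 fun t ht ht' => hnp ?_
    obtain ⟨-, h1, h2⟩ := ht
    obtain ⟨-, h3, h4⟩ := ht'
    have hlt : (n : ℝ) < p + 1 := by
      by_contra! h
      nlinarith
    have hgt : (p : ℝ) < n + 1 := by
      by_contra! h
      nlinarith
    have hlt' : n < p + 1 := by exact_mod_cast hlt
    have hgt' : p < n + 1 := by exact_mod_cast hgt
    omega
  rw [Set.iUnion_inter]
  calc volume (⋃ n : ℤ, Set.Ico (n * R - b) (n * R - a) ∩ Set.Ico 0 R)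
      ≤ ∑' n : ℤ, volume (Set.Ico (n * R - b) (n * R - a) ∩ Set.Ico 0 R) :=
        measure_iUnion_le _
    _ = ∑' n : ℤ, volume (Set.Ico (-b) (-a) ∩ Set.Ico (-(n * R)) (R - n * R)) := by
        congr 1 with n
        rw [← measure_preimage_add volume (n * R : ℝ)]
        congr 1
        ext t
        simp only [Set.mem_preimage, Set.mem_inter_iff, Set.mem_Ico]
        constructor <;> rintro ⟨⟨h1, h2⟩, h3, h4⟩ <;>
          refine ⟨⟨?_, ?_⟩, ?_, ?_⟩ <;> linarith
    _ = volume (⋃ n : ℤ, Set.Ico (-b) (-a) ∩ Set.Ico (-(n * R)) (R - n * R)) :=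
        (measure_iUnion hdisj fun n => measurableSet_Ico.inter measurableSet_Ico).symm
    _ ≤ volume (Set.Ico (-b) (-a)) :=
        measure_mono (Set.iUnion_subset fun n => Set.inter_subset_left)
    _ = ENNReal.ofReal (b - a) := by
        rw [Real.volume_Ico]
        congr 1
        ring

/-- A uniformly shifted one-dimensional grid of side `R` separates `a` and `b` with probability
at most `|a - b| / R`. -/
lemma uniformIco_floor_ne_le {R : ℝ} (hR : 0 < R) (a b : ℝ) :
    uniformIco R {u : ℝ | ⌊(a + u) / R⌋ ≠ ⌊(b + u) / R⌋} ≤ ENNReal.ofReal (|a - b| / R) := by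
  wlog hab : a ≤ b generalizing a b
  · have h := this b a (le_of_not_ge hab)
    simpa only [ne_comm, abs_sub_comm] using h
  have hsub : {u : ℝ | ⌊(a + u) / R⌋ ≠ ⌊(b + u) / R⌋} ⊆
      ⋃ n : ℤ, Set.Ico (n * R - b) (n * R - a) := by
    intro u hu
    have hle : ⌊(a + u) / R⌋ ≤ ⌊(b + u) / R⌋ := by gcongr
    have hlt := lt_of_le_of_ne hle hu
    have h1 := (le_div_iff₀ hR).1 (Int.floor_le ((b + u) / R))
    have h2 := (div_lt_iff₀ hR).1 (Int.floor_lt.1 hlt)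
    exact Set.mem_iUnion.2 ⟨⌊(b + u) / R⌋, by linarith, by linarith⟩
  rw [uniformIco, Measure.smul_apply, smul_eq_mul,
    Measure.restrict_apply (measurableSet_floor_ne R a b), ENNReal.ofReal_div_of_pos hR,
    ENNReal.div_eq_inv_mul, abs_sub_comm, abs_of_nonneg (sub_nonneg.2 hab)]
  gcongr
  exact (measure_mono (Set.inter_subset_inter_left _ hsub)).trans
    (volume_iUnion_translates_inter_Ico_le hR a b)

/-- A randomly shifted grid of side `R` separates `x` and `y` with probability at most
`‖x - y‖₁ / R`. -/
lemma pi_uniformIco_exists_floor_ne_le {ι : Type*} [Fintype ι] {R : ℝ} (hR : 0 < R)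
    (x y : ι → ℝ) :
    (Measure.pi fun _ : ι => uniformIco R)
        {u | ∃ i, ⌊(x i + u i) / R⌋ ≠ ⌊(y i + u i) / R⌋} ≤
      ENNReal.ofReal ((∑ i, |x i - y i|) / R) := by
  have := isProbabilityMeasure_uniformIco hR
  rw [Set.ofPred_exists, Finset.sum_div, ENNReal.ofReal_sum_of_nonneg fun i _ => by positivity]
  refine (measure_iUnion_fintype_le _ _).trans (Finset.sum_le_sum fun i _ => ?_)
  have h := (measurePreserving_eval (fun _ : ι => uniformIco R) i).measure_preimage
    (measurableSet_floor_ne R (x i) (y i)).nullMeasurableSet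
  exact h.trans_le (uniformIco_floor_ne_le hR (x i) (y i))

/-- Take `m` independent randomly shifted grids of side `R > 0` in `ℝ^k` (each shift vector
has independent coordinates, uniform on `[0, R)`). If `‖x − y‖₁ ≤ R/2`, then with
probability at least `1 − 2^{−m}` there is a grid in which `x` and `y` fall into
the same cell. -/
theorem randomly_shifted_grids_some_collision
    {Ω : Type} [MeasurableSpace Ω] (μ : Measure Ω) [IsProbabilityMeasure μ]
    (R : ℝ) (hR : 0 < R) (k m : ℕ) (hk : 1 ≤ k) (hm : 1 ≤ m)
    (x y : Fin k → ℝ) (hxy : ∑ i, |x i - y i| ≤ R / 2)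
    (U : Ω → Fin m → Fin k → ℝ)
    (hU : Measure.map U μ =
      Measure.pi fun _ : Fin m => Measure.pi fun _ : Fin k => uniformIco R) :
    ENNReal.ofReal (1 - (1 / 2 : ℝ) ^ m) ≤
      μ {ω | ∃ z : Fin m, ∀ i, ⌊(x i + U ω z i) / R⌋ = ⌊(y i + U ω z i) / R⌋} := by
  have hprob := isProbabilityMeasure_uniformIco hR
  have hUm : AEMeasurable U μ := by
    by_contra h
    rw [Measure.map_of_not_aemeasurable h] at hU
    exact IsProbabilityMeasure.ne_zero _ hU.symm
  set B : Set (Fin k → ℝ) := {u | ∃ i, ⌊(x i + u i) / R⌋ ≠ ⌊(y i + u i) / R⌋} with hB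
  have hBm : MeasurableSet B := by
    rw [hB, Set.ofPred_exists]
    exact MeasurableSet.iUnion fun i =>
      (measurableSet_floor_ne R (x i) (y i)).preimage (measurable_pi_apply i)
  have hBle : (Measure.pi fun _ : Fin k => uniformIco R) B ≤ ENNReal.ofReal (1 / 2) := by
    refine (pi_uniformIco_exists_floor_ne_le hR x y).trans (ENNReal.ofReal_le_ofReal ?_)
    rw [div_le_iff₀ hR]
    linarith
  have hPm : MeasurableSet (Set.univ.pi fun _ : Fin m => B) :=
    MeasurableSet.univ_pi fun _ => hBm
  have hset : {ω | ∃ z : Fin m, ∀ i, ⌊(x i + U ω z i) / R⌋ = ⌊(y i + U ω z i) / R⌋} =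
      U ⁻¹' (Set.univ.pi fun _ : Fin m => B)ᶜ := by
    ext ω
    simp [hB]
  rw [hset, ← Measure.map_apply_of_aemeasurable hUm hPm.compl, hU, prob_compl_eq_one_sub hPm,
    Measure.pi_pi, Finset.prod_const, Finset.card_univ, Fintype.card_fin,
    ENNReal.ofReal_sub _ (by positivity), ENNReal.ofReal_one,
    ENNReal.ofReal_pow (by positivity)]
  gcongr
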